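/- Let n ≥ 2, let w be a permutation of {1,…,n}, and let i be an index with |w(i) − i| ≤ 1. If the i-th flattening fl_i(w) is shallow, then w is shallow. -/

import Mathlib

/-- The (Coxeter) length of a permutation: its number of inversions,
i.e. pairs `(a,b)` with `a < b` and `w a > w b`. -/
def invLen {n : ℕ} (w : Equiv.Perm (Fin n)) : ℕ :=
  (Finset.univ.filter (fun p : Fin n × Fin n => p.1 < p.2 ∧ w p.2 < w p.1)).card

/-- The number of cycles in the cycle decomposition of `w`,
where fixed points count as cycles. -/
def numCycles {n : ℕ} (w : Equiv.Perm (Fin n)) : ℕ :=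
  w.cycleType.card + (Finset.univ.filter (fun i : Fin n => w i = i)).card

/-- The reflection length of a permutation of `{1,…,n}`: `n` minus the number of
cycles in its cycle decomposition (fixed points counting as cycles). -/
def reflLen {n : ℕ} (w : Equiv.Perm (Fin n)) : ℕ :=
  n - numCycles w

/-- The total displacement `td(w) = Σ_i |w(i) - i|`. -/
def totalDisp {n : ℕ} (w : Equiv.Perm (Fin n)) : ℕ :=
  ∑ i : Fin n, ((w i : ℤ) - (i : ℤ)).natAbs

/-- A permutation is shallow if `ℓ(w) + ℓ_T(w) = td(w)`. -/
def IsShallow {n : ℕ} (w : Equiv.Perm (Fin n)) : Prop :=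
  invLen w + reflLen w = totalDisp w

/-- The `i`-th flattening of `w`: remove the `i`-th entry of the one-line notation
and renumber down by one every entry greater than `w i`.  Position `k` of `Fin n`
corresponds to position `i.succAbove k` of `Fin (n+1)`, and value `m` corresponds
to value `(w i).succAbove m`; this is implemented by deleting the point `i` from the
source and `w i` from the target via `finSuccEquiv'`. -/
def flatten {n : ℕ} (w : Equiv.Perm (Fin (n + 1))) (i : Fin (n + 1)) : Equiv.Perm (Fin n) :=
  Equiv.removeNone ((finSuccEquiv' i).symm.trans (w.trans (finSuccEquiv' (w i))))

/-- `v` has a left-to-right maximum at position `j` if `v j > v i` for all `i < j`. -/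
def LeftToRightMaxAt {m : ℕ} (v : Equiv.Perm (Fin m)) (j : Fin m) : Prop :=
  ∀ i : Fin m, i < j → v i < v j

/-- `v` has a right-to-left minimum at position `j` if `v j < v i` for all `i > j`. -/
def RightToLeftMinAt {m : ℕ} (v : Equiv.Perm (Fin m)) (j : Fin m) : Prop :=
  ∀ i : Fin m, j < i → v j < v i

theorem succAbove_flatten {n : ℕ} (w : Equiv.Perm (Fin (n + 1))) (i : Fin (n + 1)) (k : Fin n) :
    (w i).succAbove (flatten w i k) = w (i.succAbove k) := by
  have h : some (flatten w i k) = finSuccEquiv' (w i) (w (i.succAbove k)) := by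
    have hne : w (i.succAbove k) ≠ w i := fun h => Fin.succAbove_ne i k (w.injective h)
    obtain ⟨m, hm⟩ := Fin.exists_succAbove_eq hne
    have := Equiv.removeNone_some ((finSuccEquiv' i).symm.trans (w.trans (finSuccEquiv' (w i))))
      (x := k) ⟨m, by simp [← hm]⟩
    simpa [flatten] using this
  have := congrArg (finSuccEquiv' (w i)).symm h
  simpa using this

theorem succAbove_val {n : ℕ} (i : Fin (n + 1)) (k : Fin n) :
    (i.succAbove k : ℕ) = if (k : ℕ) < i then (k : ℕ) else k + 1 := by
  simp only [Fin.succAbove, Fin.lt_def, Fin.val_castSucc]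
  split_ifs <;> simp

theorem invLen_eq_sum {n : ℕ} (w : Equiv.Perm (Fin n)) :
    invLen w = ∑ a, ∑ b, if a < b ∧ w b < w a then 1 else 0 := by
  rw [invLen, Finset.card_filter, Fintype.sum_prod_type]

theorem invLen_eq_flatten {n : ℕ} (w : Equiv.Perm (Fin (n + 1))) (i : Fin (n + 1)) :
    invLen w = invLen (flatten w i) +
      ∑ k, ((if i < i.succAbove k ∧ w (i.succAbove k) < w i then 1 else 0) +
        (if i.succAbove k < i ∧ w i < w (i.succAbove k) then 1 else 0)) := by
  rw [invLen_eq_sum, invLen_eq_sum, Fin.sum_univ_succAbove _ i, Fin.sum_univ_succAbove _ i]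
  simp_rw [Fin.sum_univ_succAbove _ i, Finset.sum_add_distrib, ← succAbove_flatten,
    Fin.succAbove_lt_succAbove_iff]
  simp only [lt_irrefl, false_and, if_false]
  ring

theorem totalDisp_eq_flatten {n : ℕ} (w : Equiv.Perm (Fin (n + 1))) (i : Fin (n + 1))
    (hi : ((w i : ℤ) - (i : ℤ)).natAbs ≤ 1) :
    totalDisp w = ((w i : ℤ) - (i : ℤ)).natAbs + totalDisp (flatten w i) +
      ∑ k, ((if i < i.succAbove k ∧ w (i.succAbove k) < w i then 1 else 0) +
        (if i.succAbove k < i ∧ w i < w (i.succAbove k) then 1 else 0)) := by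
  rw [totalDisp, totalDisp, Fin.sum_univ_succAbove _ i, add_assoc, ← Finset.sum_add_distrib]
  congr 1
  refine Finset.sum_congr rfl fun k _ => ?_
  simp only [← succAbove_flatten, Fin.lt_def, succAbove_val]
  split_ifs <;> omega

theorem reflLen_add_card_cycleType {n : ℕ} (w : Equiv.Perm (Fin n)) :
    reflLen w + w.cycleType.card = w.support.card := by
  have h1 : w.cycleType.card ≤ w.support.card := by
    rw [← Equiv.Perm.sum_cycleType]
    simpa using Multiset.card_nsmul_le_sum (s := w.cycleType) (a := 1)
      fun x hx => (Equiv.Perm.one_lt_of_mem_cycleType hx).le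
  have h2 : w.support.card + (Finset.univ.filter (fun i : Fin n => w i = i)).card = n := by
    have := Finset.card_filter_add_card_filter_not (s := (Finset.univ : Finset (Fin n)))
      (fun i : Fin n => w i ≠ i)
    simpa [Equiv.Perm.support] using this
  unfold reflLen numCycles
  omega

theorem reflLen_mul_of_disjoint {n : ℕ} {σ τ : Equiv.Perm (Fin n)} (h : σ.Disjoint τ) :
    reflLen (σ * τ) = reflLen σ + reflLen τ := by
  have h1 := reflLen_add_card_cycleType σ
  have h2 := reflLen_add_card_cycleType τ
  have h3 := reflLen_add_card_cycleType (σ * τ)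
  rw [h.cycleType_mul, h.card_support_mul, Multiset.card_add] at h3
  omega

theorem reflLen_add_one_of_isCycle {n : ℕ} {σ : Equiv.Perm (Fin n)} (h : σ.IsCycle) :
    reflLen σ + 1 = σ.support.card := by
  simpa [h.cycleType] using reflLen_add_card_cycleType σ

theorem reflLen_one {n : ℕ} : reflLen (1 : Equiv.Perm (Fin n)) = 0 := by
  simpa using reflLen_add_card_cycleType (1 : Equiv.Perm (Fin n))

theorem support_swap_mul_subset {n : ℕ} (σ : Equiv.Perm (Fin n)) (i : Fin n) :
    (Equiv.swap i (σ i) * σ).support ⊆ σ.support := by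
  intro x hx
  rw [Equiv.Perm.mem_support] at hx ⊢
  intro h
  apply hx
  by_cases hxi : x = i
  · subst hxi
    simp [h]
  · rw [Equiv.Perm.mul_apply, h]
    refine Equiv.swap_apply_of_ne_of_ne hxi fun h' => hxi ?_
    exact σ.injective (h.trans h')

theorem reflLen_swap_mul_of_isCycle {n : ℕ} {σ : Equiv.Perm (Fin n)} (h : σ.IsCycle) {i : Fin n}
    (hi : σ i ≠ i) : reflLen σ = reflLen (Equiv.swap i (σ i) * σ) + 1 := by
  by_cases h2 : σ (σ i) = i
  · have hσ := h.eq_swap_of_apply_apply_eq_self hi h2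
    have h1 : Equiv.swap i (σ i) * σ = 1 := by
      conv_lhs => rw [hσ]
      simp
    have h3 := reflLen_add_one_of_isCycle h
    rw [hσ, Equiv.Perm.card_support_swap hi.symm, ← hσ] at h3
    rw [h1, reflLen_one]
    omega
  · have h1 := reflLen_add_one_of_isCycle h
    have h3 := reflLen_add_one_of_isCycle (h.swap_mul hi h2)
    have h4 := Equiv.Perm.support_swap_mul_eq σ i h2
    rw [h4, Finset.card_sdiff_of_subset (by simpa using hi)] at h3
    have : 2 ≤ σ.support.card := h.two_le_card_support
    simp at h3
    omega

theorem reflLen_swap_mul {n : ℕ} (w : Equiv.Perm (Fin n)) {i : Fin n} (hi : w i ≠ i) :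
    reflLen w = reflLen (Equiv.swap i (w i) * w) + 1 := by
  set c := w.cycleOf i with hc
  have hci : c i = w i := Equiv.Perm.cycleOf_apply_self w i
  have hd : c.Disjoint (c⁻¹ * w) := by
    have := (Equiv.Perm.disjoint_mul_inv_of_mem_cycleFactorsFinset
      (Equiv.Perm.cycleOf_mem_cycleFactorsFinset_iff.2 (Equiv.Perm.mem_support.2 hi))).symm
    rwa [(Equiv.Perm.self_mem_cycle_factors_commute
      (Equiv.Perm.cycleOf_mem_cycleFactorsFinset_iff.2
        (Equiv.Perm.mem_support.2 hi))).inv_left.eq.symm] at this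
  have hcyc : c.IsCycle := Equiv.Perm.isCycle_cycleOf w hi
  have hd' : (Equiv.swap i (c i) * c).Disjoint (c⁻¹ * w) :=
    Equiv.Perm.disjoint_iff_disjoint_support.2
      (Finset.disjoint_of_subset_left (support_swap_mul_subset c i)
        (Equiv.Perm.disjoint_iff_disjoint_support.1 hd))
  have h1 := reflLen_mul_of_disjoint hd
  have h2 := reflLen_mul_of_disjoint hd'
  have h3 := reflLen_swap_mul_of_isCycle hcyc (hci ▸ hi)
  rw [mul_inv_cancel_left] at h1
  rw [mul_assoc, mul_inv_cancel_left, hci] at h2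
  rw [hci] at h3
  omega

theorem reflLen_flatten_of_apply_eq {n : ℕ} (w : Equiv.Perm (Fin (n + 1))) {i : Fin (n + 1)}
    (hi : w i = i) : reflLen w = reflLen (flatten w i) := by
  have h : w = (flatten w i).extendDomain (finSuccAboveEquiv i) := by
    ext x
    rcases eq_or_ne x i with rfl | hx
    · rw [Equiv.Perm.extendDomain_apply_not_subtype _ _ (by simp), hi]
    · obtain ⟨k, rfl⟩ := Fin.exists_succAbove_eq hx
      have := Equiv.Perm.extendDomain_apply_image (flatten w i)
        (finSuccAboveEquiv i) k
      rw [finSuccAboveEquiv_apply, finSuccAboveEquiv_apply] at this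
      rw [this, ← succAbove_flatten, hi]
  have h1 := reflLen_add_card_cycleType w
  have h2 := reflLen_add_card_cycleType (flatten w i)
  rw [← Equiv.Perm.sum_cycleType] at h1 h2
  have h3 : w.cycleType = (flatten w i).cycleType := by
    conv_lhs => rw [h]
    exact Equiv.Perm.cycleType_extendDomain _
  rw [h3] at h1
  omega

theorem reflLen_eq_flatten {n : ℕ} (w : Equiv.Perm (Fin (n + 1))) (i : Fin (n + 1))
    (hi : ((w i : ℤ) - (i : ℤ)).natAbs ≤ 1) :
    reflLen w = reflLen (flatten w i) + ((w i : ℤ) - (i : ℤ)).natAbs := by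
  by_cases h : w i = i
  · simp [reflLen_flatten_of_apply_eq w h, h]
  · have hfl : flatten (Equiv.swap i (w i) * w) i = flatten w i := by
      ext1 k
      apply Fin.succAbove_right_injective (p := i)
      have := succAbove_flatten (Equiv.swap i (w i) * w) i k
      rw [Equiv.Perm.mul_apply, Equiv.swap_apply_right] at this
      rw [this, Equiv.Perm.mul_apply, ← succAbove_flatten, Equiv.swap_apply_def]
      ext
      have := succAbove_val i (flatten w i k)
      have := succAbove_val (w i) (flatten w i k)
      simp only [Fin.ext_iff] at h ⊢
      split_ifs at * <;> omega
    have hne : (w i : ℕ) ≠ i := fun h' => h (Fin.ext h')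
    rw [reflLen_swap_mul w h, reflLen_flatten_of_apply_eq _ (i := i) (by simp), hfl]
    omega

/-- For `n ≥ 2`, if `i` is an index with `|w i - i| ≤ 1` and the flattening `fl_i(w)`
is shallow, then `w` is shallow. -/
theorem isShallow_of_flatten {n : ℕ} (hn : 1 ≤ n) (w : Equiv.Perm (Fin (n + 1)))
    (i : Fin (n + 1)) (hi : ((w i : ℤ) - (i : ℤ)).natAbs ≤ 1)
    (hfl : IsShallow (flatten w i)) :
    IsShallow w := by
  have h1 := invLen_eq_flatten w i
  have h2 := totalDisp_eq_flatten w i hi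
  have h3 := reflLen_eq_flatten w i hi
  unfold IsShallow at hfl ⊢
  omega
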